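/- Scalar Paley inequality for lacunary gaps (Case 2): let (k_j)_{j≥0} be strongly lacunary (k_{j+1} > 2 k_j) and let f ∈ L¹(T) be a trigonometric polynomial whose Fourier coefficients f̂(n) vanish at all positive integers n not in {k_j}. Then (∑_j |f̂(k_j)|²)^{1/2} ≤ 2 ‖f‖_{L¹(T)}. -/

import Mathlib

open MeasureTheory AddCircle Real

instance : Fact (0 < 2 * π) := ⟨by positivity⟩

section FournierPair

variable {T : ℝ}

/-- Fournier's variant of the Riesz products attached to frequencies `k` and coefficients `a`:
`G₀ = 0`, `H₀ = 1`, `Gₙ₊₁ = Gₙ + aₙ e₋ₖₙ Hₙ`, `Hₙ₊₁ = Hₙ - āₙ eₖₙ Gₙ`, where `eₘ` is the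
`m`-th Fourier monomial. -/
noncomputable def fournierPair (T : ℝ) (k : ℕ → ℕ) (a : ℕ → ℂ) :
    ℕ → C(AddCircle T, ℂ) × C(AddCircle T, ℂ)
  | 0 => (0, 1)
  | n + 1 =>
    ((fournierPair T k a n).1 + a n • (fourier (-(k n : ℤ)) * (fournierPair T k a n).2),
      (fournierPair T k a n).2 -
        (starRingEnd ℂ) (a n) • (fourier (k n : ℤ) * (fournierPair T k a n).1))

theorem Complex.sq_norm_add_mul_add_sq_norm_sub_conj_mul (w g h : ℂ) :
    ‖g + w * h‖ ^ 2 + ‖h - (starRingEnd ℂ) w * g‖ ^ 2 =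
      (1 + ‖w‖ ^ 2) * (‖g‖ ^ 2 + ‖h‖ ^ 2) := by
  simp only [Complex.sq_norm, Complex.normSq_apply, Complex.add_re, Complex.add_im,
    Complex.sub_re, Complex.sub_im, Complex.mul_re, Complex.mul_im, Complex.conj_re,
    Complex.conj_im]
  ring

theorem sq_norm_fournierPair (k : ℕ → ℕ) (a : ℕ → ℂ) (n : ℕ) (t : AddCircle T) :
    ‖(fournierPair T k a n).1 t‖ ^ 2 + ‖(fournierPair T k a n).2 t‖ ^ 2 =
      ∏ j ∈ Finset.range n, (1 + ‖a j‖ ^ 2) := by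
  induction n with
  | zero => simp [fournierPair]
  | succ n ih =>
    have h := Complex.sq_norm_add_mul_add_sq_norm_sub_conj_mul
      (a n * fourier (-(k n : ℤ)) t) ((fournierPair T k a n).1 t) ((fournierPair T k a n).2 t)
    have hnorm : ‖fourier (-(k n : ℤ)) t‖ = 1 := by
      rw [fourier_apply]; exact Circle.norm_coe _
    rw [norm_mul, hnorm, mul_one, ih, map_mul, ← fourier_neg, neg_neg] at h
    rw [Finset.prod_range_succ, mul_comm, ← h]
    simp [fournierPair, mul_assoc]

theorem norm_fournierPair_fst_le (k : ℕ → ℕ) (a : ℕ → ℂ) (n : ℕ) (t : AddCircle T) :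
    ‖(fournierPair T k a n).1 t‖ ≤ √(∏ j ∈ Finset.range n, (1 + ‖a j‖ ^ 2)) := by
  apply Real.le_sqrt_of_sq_le
  rw [← sq_norm_fournierPair k a n t]
  exact le_add_of_nonneg_right (sq_nonneg _)

theorem fourier_mul_mem_span {s s' : Set ℤ} {m : ℤ} (h : ∀ p ∈ s, m + p ∈ s')
    {u : C(AddCircle T, ℂ)} (hu : u ∈ Submodule.span ℂ (fourier '' s)) :
    fourier m * u ∈ Submodule.span ℂ (fourier '' s') := by
  induction hu using Submodule.span_induction with
  | mem u hu =>
    obtain ⟨p, hp, rfl⟩ := hu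
    have : (fourier m * fourier p : C(AddCircle T, ℂ)) = fourier (m + p) := by
      ext t; simp
    rw [this]
    exact Submodule.subset_span ⟨_, h p hp, rfl⟩
  | zero => simp
  | add u v _ _ hu hv => rw [mul_add]; exact add_mem hu hv
  | smul c u _ hu => rw [mul_smul_comm]; exact Submodule.smul_mem _ c hu

theorem lt_of_two_mul_lt_succ {k : ℕ → ℕ} (hk : ∀ j, k (j + 1) > 2 * k j) {i j : ℕ}
    (hij : i < j) : 2 * k i < k j := by
  induction j, hij using Nat.le_induction with
  | base => exact hk i
  | succ j _ ih => have := hk j; omega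

theorem fournierPair_mem_span {k : ℕ → ℕ} (hk : ∀ j, k (j + 1) > 2 * k j) (a : ℕ → ℂ) (n : ℕ) :
    (fournierPair T k a n).1 ∈
        Submodule.span ℂ (fourier '' {p : ℤ | p ≤ 0 ∧ ∃ j < n, -p ≤ k j}) ∧
      (fournierPair T k a n).2 - 1 ∈
        Submodule.span ℂ (fourier '' {p : ℤ | 0 < p ∧ ∃ j < n, p ≤ k j}) := by
  induction n with
  | zero => simp [fournierPair]
  | succ n ih =>
    obtain ⟨hG, hH⟩ := ih
    constructor
    · have hsplit : (fournierPair T k a (n + 1)).1 = (fournierPair T k a n).1 +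
          a n • (fourier (-(k n : ℤ)) +
            fourier (-(k n : ℤ)) * ((fournierPair T k a n).2 - 1)) := by
        rw [fournierPair, mul_sub, mul_one, add_sub_cancel]
      rw [hsplit]
      refine add_mem (Submodule.span_mono (Set.image_mono ?_) hG)
        (Submodule.smul_mem _ _ (add_mem (Submodule.subset_span ⟨_, ?_, rfl⟩)
          (fourier_mul_mem_span ?_ hH)))
      · rintro p ⟨hp, j, hj, hpj⟩
        exact ⟨hp, j, by omega, hpj⟩
      · exact ⟨by omega, n, by omega, by omega⟩
      · rintro p ⟨hp, j, hj, hpj⟩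
        have := lt_of_two_mul_lt_succ hk hj
        exact ⟨by omega, n, by omega, by omega⟩
    · rw [fournierPair, sub_right_comm]
      refine sub_mem (Submodule.span_mono (Set.image_mono ?_) hH)
        (Submodule.smul_mem _ _ (fourier_mul_mem_span ?_ hG))
      · rintro p ⟨hp, j, hj, hpj⟩
        exact ⟨hp, j, by omega, hpj⟩
      · rintro p ⟨hp, j, hj, hpj⟩
        have := lt_of_two_mul_lt_succ hk hj
        exact ⟨by omega, n, by omega, by omega⟩

variable [Fact (0 < T)]

theorem ContinuousMap.integrable_mul_haarAddCircle (u : C(AddCircle T, ℂ))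
    {f : AddCircle T → ℂ} (hf : Continuous f) :
    Integrable (fun t => u t * f t) haarAddCircle :=
  (u.continuous.mul hf).integrable_of_hasCompactSupport (HasCompactSupport.of_compactSpace _)

theorem integral_mul_eq_zero_of_mem_span {s : Set ℤ} {f : AddCircle T → ℂ} (hf : Continuous f)
    (h : ∀ p ∈ s, fourierCoeff f (-p) = 0) {u : C(AddCircle T, ℂ)}
    (hu : u ∈ Submodule.span ℂ (fourier '' s)) : ∫ t, u t * f t ∂haarAddCircle = 0 := by
  induction hu using Submodule.span_induction with
  | mem u hu =>
    obtain ⟨p, hp, rfl⟩ := hu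
    simpa [fourierCoeff] using h p hp
  | zero => simp
  | add u v _ _ hu hv =>
    simp only [ContinuousMap.add_apply, add_mul]
    rw [integral_add (u.integrable_mul_haarAddCircle hf) (v.integrable_mul_haarAddCircle hf),
      hu, hv, add_zero]
  | smul c u _ hu =>
    simp only [ContinuousMap.smul_apply, smul_eq_mul, mul_assoc]
    rw [integral_const_mul, hu, mul_zero]

theorem integral_fournierPair_fst_mul {k : ℕ → ℕ} (hk : ∀ j, k (j + 1) > 2 * k j) (a : ℕ → ℂ)
    {f : AddCircle T → ℂ} (hf : Continuous f)
    (hgap : ∀ n : ℤ, 0 < n → (∀ j, n ≠ (k j : ℤ)) → fourierCoeff f n = 0) (n : ℕ) :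
    ∫ t, (fournierPair T k a n).1 t * f t ∂haarAddCircle =
      ∑ j ∈ Finset.range n, a j * fourierCoeff f (k j) := by
  induction n with
  | zero => simp [fournierPair]
  | succ n ih =>
    have hzero : ∫ t, (fourier (-(k n : ℤ)) * ((fournierPair T k a n).2 - 1) : C(AddCircle T, ℂ)) t * f t
        ∂haarAddCircle = 0 := by
      refine integral_mul_eq_zero_of_mem_span (s := {q : ℤ | fourierCoeff f (-q) = 0}) hf
        (fun _ hp => hp) (fourier_mul_mem_span ?_ (fournierPair_mem_span hk a n).2)
      rintro p ⟨hp, j, hj, hpj⟩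
      have hjn := lt_of_two_mul_lt_succ hk hj
      refine hgap _ (by omega) fun i hi => ?_
      rcases lt_trichotomy i n with hin | rfl | hin
      · rcases le_or_gt i j with hij | hij
        · rcases hij.eq_or_lt with rfl | hij
          · omega
          · have := lt_of_two_mul_lt_succ hk hij
            omega
        · have := lt_of_two_mul_lt_succ hk hij
          have := lt_of_two_mul_lt_succ hk hin
          omega
      · omega
      · have := lt_of_two_mul_lt_succ hk hin
        omega
    have hsplit : ∀ t, (fournierPair T k a (n + 1)).1 t * f t =
        (fournierPair T k a n).1 t * f t + (a n * (fourier (-(k n : ℤ)) t * f t) +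
          a n * ((fourier (-(k n : ℤ)) * ((fournierPair T k a n).2 - 1) : C(AddCircle T, ℂ)) t * f t)) := by
      intro t
      simp only [fournierPair, ContinuousMap.add_apply, ContinuousMap.smul_apply,
        ContinuousMap.mul_apply, ContinuousMap.sub_apply, ContinuousMap.one_apply, smul_eq_mul]
      ring
    simp_rw [hsplit]
    have h₁ := ((fourier (-(k n : ℤ))).integrable_mul_haarAddCircle hf).const_mul (a n)
    have h₂ := ((fourier (-(k n : ℤ)) * ((fournierPair T k a n).2 - 1)).integrable_mul_haarAddCircle
      hf).const_mul (a n)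
    rw [integral_add ((fournierPair T k a n).1.integrable_mul_haarAddCircle hf)
        (by exact h₁.add h₂), integral_add h₁ h₂, integral_const_mul, integral_const_mul, hzero, ih,
      Finset.sum_range_succ, mul_zero, add_zero]
    rfl

theorem norm_sum_mul_fourierCoeff_le {k : ℕ → ℕ} (hk : ∀ j, k (j + 1) > 2 * k j) (a : ℕ → ℂ)
    {f : AddCircle T → ℂ} (hf : Continuous f)
    (hgap : ∀ n : ℤ, 0 < n → (∀ j, n ≠ (k j : ℤ)) → fourierCoeff f n = 0) (n : ℕ) :
    ‖∑ j ∈ Finset.range n, a j * fourierCoeff f (k j)‖ ≤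
      √(∏ j ∈ Finset.range n, (1 + ‖a j‖ ^ 2)) * ∫ t, ‖f t‖ ∂haarAddCircle := by
  rw [← integral_fournierPair_fst_mul hk a hf hgap n, ← integral_const_mul]
  have hint : Integrable f haarAddCircle :=
    hf.integrable_of_hasCompactSupport (HasCompactSupport.of_compactSpace _)
  refine norm_integral_le_of_norm_le (hint.norm.const_mul _) (.of_forall fun t => ?_)
  rw [norm_mul]
  gcongr
  exact norm_fournierPair_fst_le k a n t

theorem sqrt_sum_sq_norm_fourierCoeff_le {k : ℕ → ℕ} (hk : ∀ j, k (j + 1) > 2 * k j)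
    {f : AddCircle T → ℂ} (hf : Continuous f)
    (hgap : ∀ n : ℤ, 0 < n → (∀ j, n ≠ (k j : ℤ)) → fourierCoeff f n = 0) (n : ℕ) :
    √(∑ j ∈ Finset.range n, ‖fourierCoeff f (k j)‖ ^ 2) ≤
      √(Real.exp 1) * ∫ t, ‖f t‖ ∂haarAddCircle := by
  set S := √(∑ j ∈ Finset.range n, ‖fourierCoeff f (k j)‖ ^ 2) with hS
  have hsq : ∑ j ∈ Finset.range n, ‖fourierCoeff f (k j)‖ ^ 2 = S ^ 2 :=
    (Real.sq_sqrt (by positivity)).symm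
  have hS0 : 0 ≤ S := Real.sqrt_nonneg _
  rcases hS0.eq_or_lt with h0 | hpos
  · rw [← h0]; positivity
  set a : ℕ → ℂ := fun j => (starRingEnd ℂ) (fourierCoeff f (k j)) / S with ha
  have hsum : ∑ j ∈ Finset.range n, a j * fourierCoeff f (k j) = (S : ℂ) := by
    have hterm : ∀ j, a j * fourierCoeff f (k j) =
        ((‖fourierCoeff f (k j)‖ ^ 2 : ℝ) : ℂ) / S := by
      intro j
      rw [ha, div_mul_eq_mul_div, Complex.conj_mul', Complex.ofReal_pow]
    simp_rw [hterm]
    rw [← Finset.sum_div, ← Complex.ofReal_sum, hsq, ← Complex.ofReal_div]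
    congr 1
    field_simp
  have hnorm : ∑ j ∈ Finset.range n, ‖a j‖ ^ 2 = 1 := by
    simp only [ha, norm_div, RCLike.norm_conj, Complex.norm_real, Real.norm_eq_abs, div_pow,
      sq_abs]
    rw [← Finset.sum_div, hsq, div_self (by positivity)]
  have hprod : ∏ j ∈ Finset.range n, (1 + ‖a j‖ ^ 2) ≤ Real.exp 1 := by
    refine le_of_le_of_eq ?_ (congrArg Real.exp hnorm)
    rw [Real.exp_sum]
    refine Finset.prod_le_prod (fun _ _ => by positivity) fun j _ => ?_
    rw [add_comm]
    exact Real.add_one_le_exp _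
  calc S = ‖∑ j ∈ Finset.range n, a j * fourierCoeff f (k j)‖ := by
        rw [hsum, Complex.norm_real, Real.norm_of_nonneg hS0]
    _ ≤ _ := norm_sum_mul_fourierCoeff_le hk a hf hgap n
    _ ≤ _ := by gcongr

end FournierPair

/-- Scalar Paley inequality for lacunary gaps (Case 2): if `f` is a trigonometric
polynomial whose Fourier coefficients vanish at all positive integers outside the
strongly lacunary set `{k j}`, then `(∑ |f̂(k_j)|²)^{1/2} ≤ 2 ‖f‖₁`. -/
theorem stmt_15 (k : ℕ → ℕ) (hk : ∀ j, k (j + 1) > 2 * k j)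
    (f : AddCircle (2 * π) → ℂ) (hf_cont : Continuous f)
    (hf_poly : ∃ N : ℕ, ∀ n : ℤ, (N : ℤ) < |n| → fourierCoeff f n = 0)
    (hgap : ∀ n : ℤ, 0 < n → (∀ j, n ≠ (k j : ℤ)) → fourierCoeff f n = 0) :
    Real.sqrt (∑' j, ‖fourierCoeff f (k j)‖ ^ 2) ≤
      2 * ∫ t, ‖f t‖ ∂haarAddCircle := by
  have hexp : √(Real.exp 1) ≤ 2 := by
    rw [Real.sqrt_le_left (by norm_num)]
    linarith [Real.exp_one_lt_d9]
  refine Real.sqrt_le_iff.2 ⟨by positivity, ?_⟩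
  refine Real.tsum_le_of_sum_range_le (fun _ => by positivity) fun n => ?_
  refine (Real.sqrt_le_left (by positivity)).1 ?_
  exact (sqrt_sum_sq_norm_fourierCoeff_le hk hf_cont hgap n).trans (by gcongr)
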